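/- For i = 1,2 let Γᵢ be a finite 2-edge-connected oriented simple graph with edge set Eᵢ and spanning tree Tᵢ, and let G_C(Γᵢ,Tᵢ) be its q-cut Gram matrix. Then the following are equivalent: (1) there exists an isomorphism of q-cut lattices, i.e. an R-module isomorphism φ : R^{T₁} → R^{T₂} which satisfies ⟨φ(x), φ(y)⟩₂ = ⟨x,y⟩₁ for all x, y (where ⟨x,y⟩ᵢ := ∑_{e,e'} σ(x_e)·G_C(Γᵢ,Tᵢ)(e,e')·y_{e'}) and which commutes with the entrywise application of σ (this expresses compatibility with the q-antilinear involutions d fixing the fundamental-cut bases); (2) there exists a cycle-preserving bijection F : E₁ → E₂ with F(T₁) = T₂. -/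

import Mathlib

open LaurentPolynomial

/-- The incidence matrix of an oriented simple graph. -/
def incMat {V : Type} [DecidableEq V] (G : SimpleGraph V)
    (head tail : G.edgeSet → V) : Matrix V G.edgeSet ℤ :=
  fun v e => if v = head e then 1 else if v = tail e then -1 else 0

/-- `head` and `tail` form an orientation of `G`. -/
def IsOrientation {V : Type} (G : SimpleGraph V) (head tail : G.edgeSet → V) : Prop :=
  ∀ e : G.edgeSet, (e : Sym2 V) = s(head e, tail e)

/-- `T` is a spanning tree of `G`. -/
def IsSpanningTree {V : Type} [Fintype V] (G : SimpleGraph V) (T : Set G.edgeSet) : Prop :=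
  (SimpleGraph.fromEdgeSet (Subtype.val '' T)).Connected ∧ T.ncard + 1 = Fintype.card V

/-- `G` is 2-edge-connected. -/
def TwoEdgeConnected {V : Type} [Fintype V] (G : SimpleGraph V) : Prop :=
  G.Connected ∧ 1 < Fintype.card V ∧
    ∀ e ∈ G.edgeSet, (G.deleteEdges {e}).Connected

/-- `S` is the edge set of a cycle of `G`. -/
def IsCycleSet {V : Type} (G : SimpleGraph V) (S : Set G.edgeSet) : Prop :=
  ∃ (u : V) (w : G.Walk u u), w.IsCycle ∧ Subtype.val '' S = {s | s ∈ w.edges}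

/-- The q-cut Gram matrix of `(Γ,T)` built from a family `K` of fundamental cuts:
diagonal entries `1 + (⟨K_e,K_e⟩ − 1)·q²`, off-diagonal entries `⟨K_e,K_{e'}⟩·q²`. -/
noncomputable def qCutGram {V : Type} [DecidableEq V] (G : SimpleGraph V)
    [Fintype G.edgeSet] (T : Set G.edgeSet)
    (K : {e : G.edgeSet // e ∈ T} → G.edgeSet → ℤ) :
    Matrix {e : G.edgeSet // e ∈ T} {e : G.edgeSet // e ∈ T} (LaurentPolynomial ℤ) :=
  fun e e' => if e = e' then
    1 + (((∑ f, K e f * K e f) - 1 : ℤ) : LaurentPolynomial ℤ) * LaurentPolynomial.T 2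
  else (((∑ f, K e f * K e' f : ℤ)) : LaurentPolynomial ℤ) * LaurentPolynomial.T 2


/-- Ghouila-Houri property. -/
def GHProp {ι E : Type} (K : ι → E → ℤ) : Prop :=
  ∀ I : Finset ι, ∃ ε : ι → ℤ, (∀ i, ε i = 1 ∨ ε i = -1) ∧ ∀ f, |∑ i ∈ I, ε i * K i f| ≤ 1

lemma GHProp.entry {ι E : Type} {K : ι → E → ℤ} (h : GHProp K) (i : ι) (f : E) :
    K i f = 0 ∨ K i f = 1 ∨ K i f = -1 := by
  obtain ⟨ε, hε, hb⟩ := h {i}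
  have := hb f
  rw [Finset.sum_singleton, abs_le] at this
  rcases hε i with h | h <;> rw [h] at this <;> omega

lemma GHProp.pair {ι E : Type} [DecidableEq ι] {K : ι → E → ℤ} (h : GHProp K) (i j : ι) (f g : E)
    (hif : K i f ≠ 0) (hjf : K j f ≠ 0) (hig : K i g ≠ 0) (hjg : K j g ≠ 0) :
    K i f * K j f = K i g * K j g := by
  by_cases hij : i = j
  · subst hij
    rcases h.entry i f with h1 | h1 | h1 <;> rcases h.entry i g with h2 | h2 | h2 <;> simp_all
  obtain ⟨ε, hε, hb⟩ := h {i, j}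
  have hf := hb f
  have hg := hb g
  rw [Finset.sum_pair hij, abs_le] at hf hg
  rcases hε i with a | a <;> rcases hε j with b | b <;> rw [a, b] at hf hg <;>
  rcases h.entry i f with h1 | h1 | h1 <;> rcases h.entry i g with h2 | h2 | h2 <;>
  rcases h.entry j f with h3 | h3 | h3 <;> rcases h.entry j g with h4 | h4 | h4 <;>
  rw [h1, h3] at hf <;> rw [h2, h4] at hg <;> rw [h1, h2, h3, h4] <;> omega

lemma sign_aux {a b x y : ℤ} (ha : a = 1 ∨ a = -1) (hb : b = 1 ∨ b = -1)
    (hx : x = 1 ∨ x = -1) (hy : y = 1 ∨ y = -1) (h : |a * x + b * y| ≤ 1) :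
    x * y = - (a * b) := by
  rw [abs_le] at h
  rcases ha with rfl | rfl <;> rcases hb with rfl | rfl <;> rcases hx with rfl | rfl <;>
    rcases hy with rfl | rfl <;> first | rfl | (norm_num at h)

lemma GHProp.unit {ι E : Type} {K : ι → E → ℤ} (h : GHProp K) {i : ι} {f : E} (hn : K i f ≠ 0) :
    K i f = 1 ∨ K i f = -1 := by
  rcases h.entry i f with h1 | h1 | h1
  · exact absurd h1 hn
  · exact Or.inl h1
  · exact Or.inr h1

lemma GHProp.triple {ι E : Type} [DecidableEq ι] {K : ι → E → ℤ} (h : GHProp K) (i j k : ι)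
    (f g l : E)
    (hif : K i f ≠ 0) (hjf : K j f ≠ 0) (hkf : K k f = 0)
    (hjg : K j g ≠ 0) (hkg : K k g ≠ 0) (hig : K i g = 0)
    (hil : K i l ≠ 0) (hkl : K k l ≠ 0) (hjl : K j l = 0) :
    (K i f * K j f) * (K j g * K k g) * (K i l * K k l) = -1 := by
  have hij : i ≠ j := by rintro rfl; exact hil hjl
  have hik : i ≠ k := by rintro rfl; exact hif hkf
  have hjk : j ≠ k := by rintro rfl; exact hjf hkf
  obtain ⟨ε, hε, hb⟩ := h {i, j, k}
  have e1 : ∀ x, ∑ i ∈ ({i, j, k} : Finset ι), ε i * K i x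
      = ε i * K i x + ε j * K j x + ε k * K k x := by
    intro x
    rw [Finset.sum_insert (by simp [hij, hik]), Finset.sum_pair hjk, add_assoc]
  have hf := hb f
  have hg := hb g
  have hl := hb l
  rw [e1] at hf hg hl
  rw [hkf, mul_zero, add_zero] at hf
  rw [hig, mul_zero, zero_add] at hg
  rw [hjl, mul_zero, add_zero] at hl
  rw [sign_aux (hε i) (hε j) (h.unit hif) (h.unit hjf) hf,
    sign_aux (hε j) (hε k) (h.unit hjg) (h.unit hkg) hg,
    sign_aux (hε i) (hε k) (h.unit hil) (h.unit hkl) hl]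
  rcases hε i with a | a <;> rcases hε j with b | b <;> rcases hε k with c | c <;>
    rw [a, b, c] <;> norm_num

lemma GHProp.scale {ι κ E : Type} [DecidableEq κ] {K : κ → E → ℤ} (h : GHProp K) (π : ι ↪ κ) (η : ι → ℤ)
    (hη : ∀ i, η i = 1 ∨ η i = -1) : GHProp (fun i f => η i * K (π i) f) := by
  intro I
  obtain ⟨ε, hε, hb⟩ := h (I.map π)
  refine ⟨fun i => ε (π i) * η i, ?_, ?_⟩
  · intro i
    rcases hε (π i) with a | a <;> rcases hη i with b | b <;> simp [a, b]
  · intro f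
    have := hb f
    rw [Finset.sum_map] at this
    convert this using 3 with i _
    rcases hη i with b | b <;> simp [b]

open Classical in
lemma gram_eq_count {ι E : Type} [Fintype E] {K : ι → E → ℤ} (i j : ι) (s : ℤ)
    (hs : ∀ f, K i f ≠ 0 → K j f ≠ 0 → K i f * K j f = s) :
    ∑ f, K i f * K j f = s * (Finset.univ.filter (fun f => K i f ≠ 0 ∧ K j f ≠ 0)).card := by
  rw [← Finset.sum_filter_add_sum_filter_not Finset.univ (fun f => K i f ≠ 0 ∧ K j f ≠ 0)]
  rw [Finset.sum_congr rfl (g := fun _ => s)]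
  · rw [Finset.sum_eq_zero (s := Finset.univ.filter (fun f => ¬ (K i f ≠ 0 ∧ K j f ≠ 0)))]
    · simp [mul_comm]
    · intro f hf
      simp only [Finset.mem_filter, Finset.mem_univ, true_and] at hf
      by_cases h1 : K i f = 0
      · simp [h1]
      · by_cases h2 : K j f = 0
        · simp [h2]
        · exact absurd ⟨h1, h2⟩ hf
  · intro f hf
    simp only [Finset.mem_filter, Finset.mem_univ, true_and] at hf
    exact hs f hf.1 hf.2

open Classical in
lemma count_le {ι E E' : Type} [Fintype E] [Fintype E'] {K : ι → E → ℤ} {K' : ι → E' → ℤ}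
    (h : GHProp K) (h' : GHProp K')
    (hN : ∀ i j, ∑ f, K i f * K j f = ∑ f, K' i f * K' j f) (S : Finset ι) (hS : S.Nonempty) :
    (Finset.univ.filter (fun f => ∀ i ∈ S, K i f ≠ 0)).card ≤
    (Finset.univ.filter (fun f => ∀ i ∈ S, K' i f ≠ 0)).card := by
  by_cases hex : ∃ f₀, ∀ i ∈ S, K i f₀ ≠ 0
  swap
  · rw [Finset.filter_false_of_mem]
    · simp
    · intro f _ hf
      exact hex ⟨f, hf⟩
  obtain ⟨f₀, hf₀⟩ := hex
  set n : ι → ι → ℕ := fun i j => (Finset.univ.filter (fun f => K i f ≠ 0 ∧ K j f ≠ 0)).card with hn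
  set n' : ι → ι → ℕ := fun i j => (Finset.univ.filter (fun f => K' i f ≠ 0 ∧ K' j f ≠ 0)).card
    with hn'
  have hu : ∀ i ∈ S, K i f₀ = 1 ∨ K i f₀ = -1 := fun i hi => h.unit (hf₀ i hi)
  have hNn : ∀ i ∈ S, ∀ j ∈ S, ∑ f, K i f * K j f = K i f₀ * K j f₀ * n i j := by
    intro i hi j hj
    exact gram_eq_count i j _ (fun f a b => h.pair i j f f₀ a b (hf₀ i hi) (hf₀ j hj))
  have hpos : ∀ i ∈ S, ∀ j ∈ S, 0 < n i j := by
    intro i hi j hj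
    exact Finset.card_pos.2 ⟨f₀, by simp [hf₀ i hi, hf₀ j hj]⟩
  have key : ∀ i ∈ S, ∀ j ∈ S, n' i j = n i j ∧
      ∀ f, K' i f ≠ 0 → K' j f ≠ 0 → K' i f * K' j f = K i f₀ * K j f₀ := by
    intro i hi j hj
    have e := hNn i hi j hj
    rw [hN] at e
    have hp := hpos i hi j hj
    have hex : ∃ g, K' i g ≠ 0 ∧ K' j g ≠ 0 := by
      by_contra hcon
      push Not at hcon
      rw [Finset.sum_eq_zero] at e
      · rcases hu i hi with a | a <;> rcases hu j hj with b | b <;> rw [a, b] at e <;> omega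
      · intro g _
        by_cases h1 : K' i g = 0
        · simp [h1]
        · simp [hcon g h1]
    obtain ⟨g, hg1, hg2⟩ := hex
    have hall := fun f a b => h'.pair i j f g a b hg1 hg2
    have e' := gram_eq_count i j _ hall
    rw [e] at e'
    have hnn : (0:ℤ) < (Finset.univ.filter (fun f => K' i f ≠ 0 ∧ K' j f ≠ 0)).card := by
      have := Finset.card_pos.2 ⟨g, show g ∈ Finset.univ.filter
        (fun f => K' i f ≠ 0 ∧ K' j f ≠ 0) by simp [hg1, hg2]⟩
      exact_mod_cast this
    have hp' : (0:ℤ) < n i j := by exact_mod_cast hp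
    have : (n' i j : ℤ) = n i j ∧ K' i g * K' j g = K i f₀ * K j f₀ := by
      simp only [hn']
      rcases hu i hi with a | a <;> rcases hu j hj with b | b <;>
      rcases h'.unit hg1 with c | c <;> rcases h'.unit hg2 with d | d <;>
      rw [a, b, c, d] at e' <;> rw [a, b, c, d] <;> constructor <;> linarith
    refine ⟨by exact_mod_cast this.1, fun f a b => ?_⟩
    rw [hall f a b, this.2]
  obtain ⟨⟨i, j⟩, hij, hmin⟩ := Finset.exists_min_image (S ×ˢ S) (fun p => n' p.1 p.2)
    (hS.product hS)
  rw [Finset.mem_product] at hij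
  obtain ⟨hi, hj⟩ := hij
  simp only at hi hj hmin
  have main : ∀ g, K' i g ≠ 0 → K' j g ≠ 0 → ∀ k ∈ S, K' k g ≠ 0 := by
    intro g hgi hgj k hk hgk
    have step : ∀ a ∈ S, ∀ b ∈ S, n' i j = n' a b → K' a g ≠ 0 → K' b g ≠ 0 →
        ∃ l, K' a l ≠ 0 ∧ K' k l ≠ 0 ∧ K' b l = 0 := by
      intro a ha b hb hab hga hgb
      by_contra hcon
      push Not at hcon
      have hm : n' i j ≤ n' a k := hmin (a, k) (Finset.mk_mem_product ha hk)
      have : n' a k < n' a b := by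
        apply Finset.card_lt_card
        rw [Finset.ssubset_iff_of_subset]
        · exact ⟨g, by simp [hga, hgb], by simp [hgk]⟩
        · intro l hl
          simp only [Finset.mem_filter, Finset.mem_univ, true_and] at hl ⊢
          exact ⟨hl.1, hcon l hl.1 hl.2⟩
      omega
    obtain ⟨l, hl1, hl2, hl3⟩ := step i hi j hj rfl hgi hgj
    have hc : n' i j = n' j i := by simp only [hn']; simp only [and_comm]
    obtain ⟨m, hm1, hm2, hm3⟩ := step j hj i hi hc hgj hgi
    have := h'.triple i j k g m l hgi hgj hgk hm1 hm2 hm3 hl1 hl2 hl3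
    rw [(key i hi j hj).2 g hgi hgj, (key j hj k hk).2 m hm1 hm2, (key i hi k hk).2 l hl1 hl2] at this
    rcases hu i hi with a | a <;> rcases hu j hj with b | b <;> rcases hu k hk with c | c <;>
      rw [a, b, c] at this <;> norm_num at this
  calc _ ≤ n i j := by
        apply Finset.card_le_card
        intro f hf
        simp only [Finset.mem_filter, Finset.mem_univ, true_and] at hf ⊢
        exact ⟨hf i hi, hf j hj⟩
    _ = n' i j := (key i hi j hj).1.symm
    _ ≤ _ := by
        apply Finset.card_le_card
        intro f hf
        simp only [Finset.mem_filter, Finset.mem_univ, true_and] at hf ⊢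
        exact main f hf.1 hf.2

open Classical in
lemma exists_support_equiv {ι E E' : Type} [Fintype ι] [Fintype E] [Fintype E'] {K : ι → E → ℤ}
    {K' : ι → E' → ℤ} (h : GHProp K) (h' : GHProp K')
    (hN : ∀ i j, ∑ f, K i f * K j f = ∑ f, K' i f * K' j f)
    (hne : ∀ f, ∃ i, K i f ≠ 0) (hne' : ∀ f, ∃ i, K' i f ≠ 0) :
    ∃ F : E ≃ E', ∀ i f, K' i (F f) ≠ 0 ↔ K i f ≠ 0 := by
  set s : E → Finset ι := fun f => Finset.univ.filter (fun i => K i f ≠ 0) with hs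
  set s' : E' → Finset ι := fun f => Finset.univ.filter (fun i => K' i f ≠ 0) with hs'
  have hcount : ∀ S : Finset ι, S.Nonempty →
      (Finset.univ.filter (fun f => S ⊆ s f)).card = (Finset.univ.filter (fun f => S ⊆ s' f)).card := by
    intro S hS
    have a := count_le h h' hN S hS
    have b := count_le h' h (fun i j => (hN i j).symm) S hS
    have := le_antisymm a b
    convert this using 4 with f _ f _ <;> simp [hs, hs', Finset.subset_iff]
  have hdec : ∀ {A : Type} [Fintype A] (t : A → Finset ι) (S : Finset ι),
      (Finset.univ.filter (fun f => S ⊆ t f)).card =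
      (Finset.univ.filter (fun f => t f = S)).card +
        ∑ S' ∈ Finset.univ.filter (fun S' => S ⊂ S'), (Finset.univ.filter (fun f => t f = S')).card := by
    intro A _ t S
    rw [← Finset.card_biUnion]
    · rw [← Finset.card_union_of_disjoint]
      · congr 1
        ext f
        simp only [Finset.mem_filter, Finset.mem_univ, true_and, Finset.mem_union, Finset.mem_biUnion]
        constructor
        · intro hf
          rcases hf.eq_or_ssubset with h | h
          · exact Or.inl h.symm
          · exact Or.inr ⟨_, h, rfl⟩
        · rintro (h | ⟨S', h, rfl⟩)
          · exact h.ge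
          · exact h.1
      · rw [Finset.disjoint_left]
        intro f hf hf2
        simp only [Finset.mem_filter, Finset.mem_univ, true_and, Finset.mem_biUnion] at hf hf2
        obtain ⟨S', h1, h2⟩ := hf2
        rw [← hf, ← h2] at h1
        exact h1.ne rfl
    · intro S1 _ S2 _ hne
      rw [Function.onFun, Finset.disjoint_left]
      intro f hf hf2
      simp only [Finset.mem_filter, Finset.mem_univ, true_and] at hf hf2
      exact hne (hf.symm.trans hf2)
  have hexact : ∀ S : Finset ι, S.Nonempty →
      (Finset.univ.filter (fun f => s f = S)).card = (Finset.univ.filter (fun f => s' f = S)).card := by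
    intro S
    induction hm : Fintype.card ι - S.card using Nat.strong_induction_on generalizing S with
    | _ m ih =>
      intro hS
      have a := hcount S hS
      rw [hdec s S, hdec s' S, Finset.sum_congr rfl (g := fun S' =>
        (Finset.univ.filter (fun f => s' f = S')).card)] at a
      · exact Nat.add_right_cancel a
      · intro S' hS'
        simp only [Finset.mem_filter, Finset.mem_univ, true_and] at hS'
        have h1 := Finset.card_lt_card hS'
        have h2 := Finset.card_le_univ S'
        exact ih _ (by omega) S' rfl (hS.mono hS'.1)
  have hfib : ∀ S : Finset ι, Nonempty ({f // s f = S} ≃ {f // s' f = S}) := by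
    intro S
    rw [← Fintype.card_eq]
    by_cases hS : S.Nonempty
    · rw [Fintype.card_subtype, Fintype.card_subtype]
      exact hexact S hS
    · rw [Finset.not_nonempty_iff_eq_empty] at hS
      subst hS
      have : IsEmpty {f // s f = ∅} := ⟨fun ⟨f, hf⟩ => by
        obtain ⟨i, hi⟩ := hne f
        have : i ∈ s f := by simp [hs, hi]
        simp [hf] at this⟩
      have : IsEmpty {f // s' f = ∅} := ⟨fun ⟨f, hf⟩ => by
        obtain ⟨i, hi⟩ := hne' f
        have : i ∈ s' f := by simp [hs', hi]
        simp [hf] at this⟩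
      simp
  refine ⟨Equiv.ofFiberEquiv (fun S => (hfib S).some), fun i f => ?_⟩
  have := Equiv.ofFiberEquiv_map (fun S => (hfib S).some) f
  have h2 := congrArg (fun S => i ∈ S) this
  simpa [hs, hs'] using h2

/-- Product of a sign function along a walk. -/
def walkSign {ι : Type} {H : SimpleGraph ι} (δ : ι → ι → ℤ) : {u v : ι} → H.Walk u v → ℤ
  | _, _, .nil => 1
  | _, _, .cons (u := a) (v := b) _ p => δ a b * walkSign δ p

lemma walkSign_append {ι : Type} {H : SimpleGraph ι} (δ : ι → ι → ℤ) {u v w : ι}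
    (p : H.Walk u v) (q : H.Walk v w) :
    walkSign δ (p.append q) = walkSign δ p * walkSign δ q := by
  induction p with
  | nil => simp [walkSign]
  | cons h p ih => simp [walkSign, ih, mul_assoc]

lemma walkSign_reverse {ι : Type} {H : SimpleGraph ι} (δ : ι → ι → ℤ)
    (hsym : ∀ a b, H.Adj a b → δ a b = δ b a) {u v : ι}
    (p : H.Walk u v) : walkSign δ p.reverse = walkSign δ p := by
  induction p with
  | nil => simp [walkSign]
  | cons h p ih =>
    simp only [SimpleGraph.Walk.reverse_cons, walkSign_append, ih, walkSign]
    rw [hsym _ _ h]; ring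

lemma walkSign_unit {ι : Type} {H : SimpleGraph ι} (δ : ι → ι → ℤ)
    (hu : ∀ a b, H.Adj a b → δ a b = 1 ∨ δ a b = -1) {u v : ι}
    (p : H.Walk u v) : walkSign δ p = 1 ∨ walkSign δ p = -1 := by
  induction p with
  | nil => simp [walkSign]
  | cons h p ih =>
    simp only [walkSign]
    rcases hu _ _ h with a | a <;> rcases ih with b | b <;> simp [a, b]

lemma walk_split_dart {ι : Type} {H : SimpleGraph ι} {u v : ι} (p : H.Walk u v) (d : H.Dart)
    (hd : d ∈ p.darts) : ∃ (q₁ : H.Walk u d.fst) (q₂ : H.Walk d.snd v),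
      p = q₁.append (.cons d.adj q₂) := by
  induction p with
  | nil => simp at hd
  | cons h p ih =>
    rw [SimpleGraph.Walk.darts_cons, List.mem_cons] at hd
    rcases hd with rfl | hd
    · exact ⟨.nil, p, rfl⟩
    · obtain ⟨q₁, q₂, e⟩ := ih hd
      exact ⟨.cons h q₁, q₂, by simp [e]⟩

lemma walkSign_of_potential {ι : Type} {H : SimpleGraph ι} (δ : ι → ι → ℤ) (η : ι → ℤ)
    (hη : ∀ i, η i = 1 ∨ η i = -1) {u v : ι} (p : H.Walk u v)
    (h : ∀ d ∈ p.darts, δ d.fst d.snd = η d.fst * η d.snd) : walkSign δ p = η u * η v := by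
  induction p with
  | @nil u => rcases hη u with a | a <;> simp [walkSign, a]
  | @cons u w v hadj p ih =>
    simp only [walkSign]
    rw [ih (fun d hd => h d (by simp [hd])), h ⟨(u, w), hadj⟩ (by simp)]
    rcases hη w with a | a <;> simp [a]

lemma sum_two {ι : Type} [DecidableEq ι] (I : Finset ι) (a b : ι) (hab : a ≠ b) (ha : a ∈ I)
    (hb : b ∈ I) (g : ι → ℤ) (h0 : ∀ x ∈ I, x ≠ a → x ≠ b → g x = 0) :
    ∑ i ∈ I, g i = g a + g b := by
  rw [← Finset.sum_pair hab]
  symm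
  apply Finset.sum_subset
  · intro x hx
    simp only [Finset.mem_insert, Finset.mem_singleton] at hx
    rcases hx with rfl | rfl <;> assumption
  · intro x hx hx'
    simp only [Finset.mem_insert, Finset.mem_singleton, not_or] at hx'
    exact h0 x hx hx'.1 hx'.2

lemma sq_unit {a : ℤ} (h : a = 1 ∨ a = -1) : a * a = 1 := by
  rcases h with rfl | rfl <;> rfl

open Classical in
lemma closed_walk_sign {ι E : Type} {K K' : ι → E → ℤ} (h : GHProp K)
    (h' : GHProp K') (hsupp : ∀ i f, K' i f ≠ 0 ↔ K i f ≠ 0) (δ : ι → ι → ℤ)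
    (hδ : ∀ a b f, K a f ≠ 0 → K b f ≠ 0 → δ a b = K a f * K b f * (K' a f * K' b f))
    (H : SimpleGraph ι) (hH : ∀ a b, H.Adj a b ↔ a ≠ b ∧ ∃ f, K a f ≠ 0 ∧ K b f ≠ 0) (n : ℕ) :
    ∀ (u : ι) (w : H.Walk u u), w.length = n → walkSign δ w = 1 := by
  induction n using Nat.strong_induction_on with
  | _ n ih =>
  intro u w hw
  have hun : ∀ a b, H.Adj a b → δ a b = 1 ∨ δ a b = -1 := by
    intro a b hab
    obtain ⟨_, f, h1, h2⟩ := (hH a b).1 hab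
    rw [hδ a b f h1 h2]
    rcases h.unit h1 with e1 | e1 <;> rcases h.unit h2 with e2 | e2 <;>
    rcases h'.unit ((hsupp a f).2 h1) with e3 | e3 <;>
    rcases h'.unit ((hsupp b f).2 h2) with e4 | e4 <;> simp [e1, e2, e3, e4]
  by_contra hbad
  obtain ⟨ε, hε, hb⟩ := h w.support.toFinset
  obtain ⟨ε', hε', hb'⟩ := h' w.support.toFinset
  apply hbad
  have hη : ∀ i, ε i * ε' i = 1 ∨ ε i * ε' i = -1 := by
    intro i
    rcases hε i with a | a <;> rcases hε' i with b | b <;> simp [a, b]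
  rw [walkSign_of_potential δ (fun i => ε i * ε' i) hη w, sq_unit (hη u)]
  rintro ⟨⟨a, b⟩, hab⟩ hd
  simp only
  have ha : a ∈ w.support := w.dart_fst_mem_support_of_mem_darts hd
  have hbs : b ∈ w.support := w.dart_snd_mem_support_of_mem_darts hd
  obtain ⟨hne, f, haf, hbf⟩ := (hH a b).1 hab
  have hout : ∀ x ∈ w.support.toFinset, x ≠ a → x ≠ b → K x f = 0 := by
    intro x hx hxa hxb
    by_contra hxf
    apply hbad
    rw [List.mem_toFinset] at hx
    obtain ⟨q₁, q₂, e⟩ := walk_split_dart w _ hd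
    simp only at q₁ q₂ e
    have hxp : x ∈ (q₂.append q₁).support := by
      rw [e] at hx
      simp only [SimpleGraph.Walk.mem_support_append_iff, SimpleGraph.Walk.support_cons,
        List.mem_cons] at hx ⊢
      rcases hx with hx | hx | hx
      · exact Or.inr hx
      · exact absurd hx hxa
      · exact Or.inl hx
    obtain ⟨p₁, p₂, e2⟩ := SimpleGraph.Walk.mem_support_iff_exists_append.1 hxp
    have hsg : walkSign δ w = δ a b * (walkSign δ p₁ * walkSign δ p₂) := by
      rw [← walkSign_append, ← e2, e]
      simp only [walkSign_append, walkSign]; ring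
    have hlen : w.length = 1 + p₁.length + p₂.length := by
      have := congrArg SimpleGraph.Walk.length e2
      rw [SimpleGraph.Walk.length_append, SimpleGraph.Walk.length_append] at this
      rw [e, SimpleGraph.Walk.length_append, SimpleGraph.Walk.length_cons]
      omega
    have hl1 : 0 < p₁.length := by
      rcases Nat.eq_zero_or_pos p₁.length with h0 | h0
      · exact absurd (SimpleGraph.Walk.eq_of_length_eq_zero h0).symm hxb
      · exact h0
    have hl2 : 0 < p₂.length := by
      rcases Nat.eq_zero_or_pos p₂.length with h0 | h0
      · exact absurd (SimpleGraph.Walk.eq_of_length_eq_zero h0) hxa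
      · exact h0
    have hxb' : H.Adj x b := (hH x b).2 ⟨hxb, f, hxf, hbf⟩
    have hax' : H.Adj a x := (hH a x).2 ⟨Ne.symm hxa, f, haf, hxf⟩
    have s1 := ih (p₁.append (.cons hxb' .nil)).length
      (by simp; omega) b _ rfl
    have s2 := ih (p₂.append (.cons hax' .nil)).length
      (by simp; omega) x _ rfl
    simp only [walkSign_append, walkSign, mul_one] at s1 s2
    rw [hδ x b f hxf hbf] at s1
    rw [hδ a x f haf hxf] at s2
    rw [hsg, hδ a b f haf hbf]
    have k1 := sq_unit (h.unit haf)
    have k2 := sq_unit (h.unit hbf)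
    have k3 := sq_unit (h.unit hxf)
    have k1' := sq_unit (h'.unit ((hsupp a f).2 haf))
    have k2' := sq_unit (h'.unit ((hsupp b f).2 hbf))
    have k3' := sq_unit (h'.unit ((hsupp x f).2 hxf))
    have : walkSign δ p₁ = K x f * K b f * (K' x f * K' b f) := by
      have e5 : (K x f * K b f * (K' x f * K' b f)) * (K x f * K b f * (K' x f * K' b f)) = 1 := by
        calc _ = (K x f * K x f) * (K b f * K b f) * ((K' x f * K' x f) * (K' b f * K' b f)) := by ring
          _ = 1 := by rw [k2, k3, k2', k3']; rfl
      calc walkSign δ p₁ = walkSign δ p₁ * ((K x f * K b f * (K' x f * K' b f)) *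
            (K x f * K b f * (K' x f * K' b f))) := by rw [e5, mul_one]
        _ = _ := by rw [← mul_assoc, s1, one_mul]
    rw [this]
    calc _ = (K b f * K b f) * (K' b f * K' b f) *
        (walkSign δ p₂ * (K a f * K x f * (K' a f * K' x f))) := by ring
      _ = 1 := by rw [k2, k2', s2]; rfl
  have t1 := hb f
  rw [sum_two _ a b hne (by simpa using ha) (by simpa using hbs) _
    (fun x hx h1 h2 => by rw [hout x hx h1 h2, mul_zero])] at t1
  have t2 := hb' f
  rw [sum_two _ a b hne (by simpa using ha) (by simpa using hbs) _
    (fun x hx h1 h2 => by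
      have := hout x hx h1 h2
      have : K' x f = 0 := by
        by_contra hc
        exact (hsupp x f).1 hc this
      rw [this, mul_zero])] at t2
  rw [hδ a b f haf hbf, sign_aux (hε a) (hε b) (h.unit haf) (h.unit hbf) t1,
    sign_aux (hε' a) (hε' b) (h'.unit ((hsupp a f).2 haf)) (h'.unit ((hsupp b f).2 hbf)) t2]
  ring

open Classical in
lemma exists_signs {ι E : Type} [Fintype E] {K K' : ι → E → ℤ} (h : GHProp K)
    (h' : GHProp K') (hsupp : ∀ i f, K' i f ≠ 0 ↔ K i f ≠ 0) :
    ∃ ε : ι → ℤ, (∀ i, ε i = 1 ∨ ε i = -1) ∧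
      ∀ i j, ∑ f, K i f * K j f = ε i * ε j * ∑ f, K' i f * K' j f := by
  let H : SimpleGraph ι :=
    { Adj := fun a b => a ≠ b ∧ ∃ f, K a f ≠ 0 ∧ K b f ≠ 0
      symm := ⟨fun a b ⟨h1, f, h2, h3⟩ => ⟨h1.symm, f, h3, h2⟩⟩
      loopless := ⟨fun a h => h.1 rfl⟩ }
  let δ : ι → ι → ℤ := fun a b => if hf : ∃ f, K a f ≠ 0 ∧ K b f ≠ 0 then
    K a hf.choose * K b hf.choose * (K' a hf.choose * K' b hf.choose) else 1
  have hδ : ∀ a b f, K a f ≠ 0 → K b f ≠ 0 → δ a b = K a f * K b f * (K' a f * K' b f) := by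
    intro a b f h1 h2
    have hf : ∃ f, K a f ≠ 0 ∧ K b f ≠ 0 := ⟨f, h1, h2⟩
    simp only [δ, dif_pos hf]
    have hc := hf.choose_spec
    rw [h.pair a b hf.choose f hc.1 hc.2 h1 h2, h'.pair a b hf.choose f ((hsupp _ _).2 hc.1)
      ((hsupp _ _).2 hc.2) ((hsupp _ _).2 h1) ((hsupp _ _).2 h2)]
  have hclosed := fun u w => closed_walk_sign h h' hsupp δ hδ H (fun a b => Iff.rfl) _ u w rfl
  have hun : ∀ a b, H.Adj a b → δ a b = 1 ∨ δ a b = -1 := by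
    intro a b hab
    obtain ⟨_, f, h1, h2⟩ := hab
    rw [hδ a b f h1 h2]
    rcases h.unit h1 with e1 | e1 <;> rcases h.unit h2 with e2 | e2 <;>
    rcases h'.unit ((hsupp a f).2 h1) with e3 | e3 <;>
    rcases h'.unit ((hsupp b f).2 h2) with e4 | e4 <;> simp [e1, e2, e3, e4]
  have hsym : ∀ a b, H.Adj a b → δ a b = δ b a := by
    intro a b hab
    obtain ⟨_, f, h1, h2⟩ := hab
    rw [hδ a b f h1 h2, hδ b a f h2 h1]; ring
  have hrep : ∀ c : H.ConnectedComponent, ∃ v, H.connectedComponentMk v = c :=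
    fun c => c.exists_rep
  choose rep hrep using hrep
  have hw : ∀ i, Nonempty (H.Walk (rep (H.connectedComponentMk i)) i) := by
    intro i
    exact SimpleGraph.ConnectedComponent.exact (hrep _)
  let ε : ι → ℤ := fun i => walkSign δ (hw i).some
  have hε : ∀ i, ε i = 1 ∨ ε i = -1 := fun i => walkSign_unit δ hun _
  have hind : ∀ u v (p q : H.Walk u v), walkSign δ p = walkSign δ q := by
    intro u v p q
    have := hclosed u (p.append q.reverse)
    rw [walkSign_append, walkSign_reverse δ hsym] at this
    rcases walkSign_unit δ hun p with a | a <;> rcases walkSign_unit δ hun q with b | b <;>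
      rw [a, b] at this ⊢ <;> norm_num at this
  have hcob : ∀ a b, H.Adj a b → δ a b = ε a * ε b := by
    intro a b hab
    have hc : H.connectedComponentMk a = H.connectedComponentMk b :=
      SimpleGraph.ConnectedComponent.sound hab.reachable
    have : ∀ (r : ι) (p : H.Walk (rep (H.connectedComponentMk a)) a) (hr : rep (H.connectedComponentMk a) = r) (q : H.Walk r b),
        δ a b = walkSign δ p * walkSign δ q := by
      rintro r p rfl q
      have e := hind _ _ q (p.append (.cons hab .nil))
      rw [e, walkSign_append]
      simp only [walkSign, mul_one]
      rw [← mul_assoc, sq_unit (walkSign_unit δ hun p), one_mul]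
    exact this _ _ (by rw [hc]) _
  refine ⟨ε, hε, fun i j => ?_⟩
  rw [Finset.mul_sum]
  apply Finset.sum_congr rfl
  intro f _
  by_cases hi : K i f = 0
  · have : K' i f = 0 := by
      by_contra hc; exact (hsupp i f).1 hc hi
    simp [hi, this]
  by_cases hj : K j f = 0
  · have : K' j f = 0 := by
      by_contra hc; exact (hsupp j f).1 hc hj
    simp [hj, this]
  have ki := h.unit hi
  have kj := h.unit hj
  have ki' := h'.unit ((hsupp i f).2 hi)
  have kj' := h'.unit ((hsupp j f).2 hj)
  by_cases hij : i = j
  · subst hij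
    rw [sq_unit ki, sq_unit ki', sq_unit (hε i), one_mul]
  · rw [← hcob i j ⟨hij, f, hi, hj⟩, hδ i j f hi hj]
    calc K i f * K j f = K i f * K j f * ((K' i f * K' i f) * (K' j f * K' j f)) := by
          rw [sq_unit ki', sq_unit kj']; ring
      _ = _ := by ring

lemma sigma_coeff (σ : LaurentPolynomial ℤ →+* LaurentPolynomial ℤ)
    (hσ : σ (LaurentPolynomial.T 1) = LaurentPolynomial.T (-1)) (p : LaurentPolynomial ℤ) :
    σ p = LaurentPolynomial.invert p := by
  have hnat : ∀ n : ℕ, σ (LaurentPolynomial.T n) = LaurentPolynomial.T (-n) := by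
    intro n
    have : (LaurentPolynomial.T (n:ℤ) : LaurentPolynomial ℤ) = LaurentPolynomial.T 1 ^ n := by
      rw [LaurentPolynomial.T_pow]; simp
    rw [this, map_pow, hσ, LaurentPolynomial.T_pow]; simp
  have hneg : ∀ n : ℕ, σ (LaurentPolynomial.T (-n)) = LaurentPolynomial.T n := by
    intro n
    have e : σ (LaurentPolynomial.T (-n) * LaurentPolynomial.T n) = 1 := by
      rw [← LaurentPolynomial.T_add]; simp
    rw [map_mul, hnat] at e
    calc σ (LaurentPolynomial.T (-n)) = σ (LaurentPolynomial.T (-n)) *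
          (LaurentPolynomial.T (-n) * LaurentPolynomial.T n) := by
            rw [← LaurentPolynomial.T_add]; simp
      _ = _ := by rw [← mul_assoc, e, one_mul]
  induction p using LaurentPolynomial.induction_on' with
  | add p q hp hq => simp [hp, hq]
  | C_mul_T n a =>
    have : (LaurentPolynomial.C a : LaurentPolynomial ℤ) = (a : LaurentPolynomial ℤ) := by simp
    rw [map_mul, map_mul, this, map_intCast, map_intCast, LaurentPolynomial.invert_T]
    congr 1
    obtain ⟨m, rfl | rfl⟩ := Int.eq_nat_or_neg n
    · exact hnat m
    · rw [hneg]; simp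

lemma coeff_zero_mul_invert (p : LaurentPolynomial ℤ) :
    (p * LaurentPolynomial.invert p).coeff 0 = ∑ n ∈ p.coeff.support, p.coeff n * p.coeff n := by
  rw [AddMonoidAlgebra.coeff_mul_apply_left, Finsupp.sum]
  apply Finset.sum_congr rfl
  intro n _
  rw [LaurentPolynomial.invert_apply]
  simp

lemma sum_sq_pair {κ : Type} [DecidableEq κ] (s : Finset κ) (c : κ → ℤ) (hc : ∀ k, 0 ≤ c k)
    (h : ∑ k ∈ s, c k = 1) {a b : κ} (hab : a ≠ b) (ha : a ∈ s) (hb : b ∈ s) : c a + c b ≤ 1 := by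
  rw [← h, ← Finset.sum_pair hab]
  apply Finset.sum_le_sum_of_subset_of_nonneg
  · intro x hx
    simp only [Finset.mem_insert, Finset.mem_singleton] at hx
    rcases hx with rfl | rfl <;> assumption
  · intro i _ _
    exact hc i

lemma sym_sq_sum {κ : Type} [Fintype κ] (P : κ → LaurentPolynomial ℤ)
    (hP : ∀ k, LaurentPolynomial.invert (P k) = P k) (h : ∑ k, P k * P k = 1) :
    ∃ k, ∃ ε : ℤ, (ε = 1 ∨ ε = -1) ∧ P k = (ε : LaurentPolynomial ℤ) ∧ ∀ k', k' ≠ k → P k' = 0 := by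
  classical
  set c : κ → ℤ := fun k => ∑ n ∈ (P k).coeff.support, (P k).coeff n * (P k).coeff n with hc
  have hc0 : ∀ k, 0 ≤ c k := fun k => Finset.sum_nonneg (fun n _ => mul_self_nonneg _)
  have hsum : ∑ k, c k = 1 := by
    have h2 : (∑ k, P k * LaurentPolynomial.invert (P k)).coeff 0 = 1 := by
      simp only [hP, h]
      rw [← LaurentPolynomial.T_zero, LaurentPolynomial.T_apply]; simp
    rw [AddMonoidAlgebra.coeff_sum, Finsupp.finsetSum_apply] at h2
    rw [← h2]
    exact Finset.sum_congr rfl (fun k _ => (coeff_zero_mul_invert _).symm)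
  have hz : ∀ k, c k = 0 → P k = 0 := by
    intro k hk
    ext n
    by_contra hn
    rw [hc] at hk
    simp only at hk
    rw [Finset.sum_eq_zero_iff_of_nonneg (fun n _ => mul_self_nonneg _)] at hk
    have := hk n (by simpa using hn)
    exact hn (by simpa using this)
  have hex : ∃ k, c k ≠ 0 := by
    by_contra hcon
    push Not at hcon
    rw [Finset.sum_eq_zero (fun k _ => hcon k)] at hsum
    exact absurd hsum (by norm_num)
  obtain ⟨k, hk⟩ := hex
  have hother : ∀ k', k' ≠ k → c k' = 0 := by
    intro k' hk'
    have := sum_sq_pair Finset.univ c hc0 hsum hk' (Finset.mem_univ _) (Finset.mem_univ _)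
    have := hc0 k
    have := hc0 k'
    omega
  have hk1 : c k = 1 := by
    rw [Finset.sum_eq_single k (fun b _ hb => hother b hb) (by simp)] at hsum
    exact hsum
  have hsymm : ∀ n, (P k).coeff (-n) = (P k).coeff n := by
    intro n
    rw [← LaurentPolynomial.invert_apply, hP]
  have hn0 : ∀ n, n ≠ 0 → (P k).coeff n = 0 := by
    intro n hn
    by_contra hne
    have := sum_sq_pair (P k).coeff.support (fun n => (P k).coeff n * (P k).coeff n)
      (fun n => mul_self_nonneg _) hk1 (a := n) (b := -n) (by omega) (by simpa using hne)
      (by simpa [hsymm] using hne)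
    simp only [hsymm] at this
    have h3 : 0 < (P k).coeff n * (P k).coeff n := mul_self_pos.2 hne
    omega
  have hPk : P k = (((P k).coeff 0 : ℤ) : LaurentPolynomial ℤ) := by
    have : ((((P k).coeff 0 : ℤ)) : LaurentPolynomial ℤ) = LaurentPolynomial.C ((P k).coeff 0) := by
      simp
    rw [this]
    ext n
    rw [LaurentPolynomial.C_apply]
    split_ifs with h
    · rw [h]
    · exact hn0 n h
  refine ⟨k, (P k).coeff 0, ?_, hPk, fun k' hk' => hz k' (hother k' hk')⟩
  have h1 : (P k).coeff 0 * (P k).coeff 0 = 1 := by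
    rw [← hk1]
    simp only [hc]
    rw [Finset.sum_eq_single 0]
    · intro n _ hn
      rw [hn0 n hn]; simp
    · intro hn
      simpa using hn
  exact Int.isUnit_iff.1 (IsUnit.of_mul_eq_one _ h1)

/-- The abstract form of the `q`-Gram matrix. -/
noncomputable def qG {ι : Type} [DecidableEq ι] (N : ι → ι → ℤ) (e e' : ι) : LaurentPolynomial ℤ :=
  if e = e' then 1 + ((N e e - 1 : ℤ) : LaurentPolynomial ℤ) * LaurentPolynomial.T 2
  else ((N e e' : ℤ) : LaurentPolynomial ℤ) * LaurentPolynomial.T 2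

lemma qG_eq {ι : Type} [DecidableEq ι] (N : ι → ι → ℤ) (e e' : ι) :
    qG N e e' = (if e = e' then 1 else 0) +
      ((N e e' - (if e = e' then 1 else 0) : ℤ) : LaurentPolynomial ℤ) * LaurentPolynomial.T 2 := by
  unfold qG
  split_ifs with h
  · rw [h]
  · simp

lemma intCast_inj' {a b : ℤ} (h : (a : LaurentPolynomial ℤ) = b) : a = b := by
  have h2 : (LaurentPolynomial.C a : LaurentPolynomial ℤ) = LaurentPolynomial.C b := by
    simpa using h
  have := congrArg (fun p => p.coeff 0) h2
  simpa only [LaurentPolynomial.C_apply, if_true] using this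

lemma laurent_fwd {ι κ : Type} [Fintype ι] [Fintype κ] [DecidableEq ι] [DecidableEq κ]
    (σ : LaurentPolynomial ℤ →+* LaurentPolynomial ℤ)
    (hσ : σ (LaurentPolynomial.T 1) = LaurentPolynomial.T (-1))
    (N₁ : ι → ι → ℤ) (N₂ : κ → κ → ℤ)
    (φ : (ι → LaurentPolynomial ℤ) ≃ₗ[LaurentPolynomial ℤ] (κ → LaurentPolynomial ℤ))
    (hform : ∀ x y, (∑ e, ∑ e', σ (φ x e) * qG N₂ e e' * φ y e')
          = ∑ e, ∑ e', σ (x e) * qG N₁ e e' * y e')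
    (hbar : ∀ x, φ (fun e => σ (x e)) = fun e' => σ (φ x e')) :
    ∃ (π : ι ≃ κ) (ε : ι → ℤ), (∀ i, ε i = 1 ∨ ε i = -1) ∧
      ∀ a b, N₁ a b = ε a * ε b * N₂ (π a) (π b) := by
  set P : ι → κ → LaurentPolynomial ℤ := fun a k => φ (Pi.single a 1) k with hP
  have hPσ : ∀ a k, σ (P a k) = P a k := by
    intro a k
    have h1 := congrFun (hbar (Pi.single a 1)) k
    rw [hP]
    simp only
    rw [← h1]
    have h2 : (fun e => σ ((Pi.single a 1 : ι → LaurentPolynomial ℤ) e)) = Pi.single a 1 := by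
      funext e
      by_cases he : e = a
      · subst he; simp
      · simp [he]
    rw [h2]
  have hσT : σ (LaurentPolynomial.T 2) = LaurentPolynomial.T (-2) := by
    rw [sigma_coeff σ hσ, LaurentPolynomial.invert_T]
  set X : ι → ι → LaurentPolynomial ℤ := fun a b => ∑ k, P a k * P b k with hX
  set Y : ι → ι → LaurentPolynomial ℤ := fun a b => ∑ k, ∑ k', P a k *
    ((N₂ k k' - (if k = k' then 1 else 0) : ℤ) : LaurentPolynomial ℤ) * P b k' with hY
  have hXσ : ∀ a b, σ (X a b) = X a b := by
    intro a b; simp only [hX, map_sum, map_mul, hPσ]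
  have hYσ : ∀ a b, σ (Y a b) = Y a b := by
    intro a b; simp only [hY, map_sum, map_mul, hPσ, map_intCast]
  have heq : ∀ a b, X a b + Y a b * LaurentPolynomial.T 2 = (if a = b then 1 else 0) +
      ((N₁ a b - (if a = b then 1 else 0) : ℤ) : LaurentPolynomial ℤ) * LaurentPolynomial.T 2 := by
    intro a b
    have h1 := hform (Pi.single a 1) (Pi.single b 1)
    rw [← qG_eq]
    have h2 : ∑ e, ∑ e', σ ((Pi.single a 1 : ι → LaurentPolynomial ℤ) e) * qG N₁ e e' *
        (Pi.single b 1 : ι → LaurentPolynomial ℤ) e' = qG N₁ a b := by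
      rw [Finset.sum_eq_single a, Finset.sum_eq_single b]
      · simp
      · intro e _ he; simp [he]
      · simp
      · intro e _ he
        apply Finset.sum_eq_zero
        intro e' _
        simp [he]
      · simp
    rw [h2] at h1
    rw [← h1]
    simp only [hX, hY]
    rw [Finset.sum_mul, ← Finset.sum_add_distrib]
    apply Finset.sum_congr rfl
    intro k _
    have h3 : P a k * P b k = ∑ k', P a k * (if k = k' then 1 else 0) * P b k' := by
      rw [Finset.sum_eq_single k]
      · simp
      · intro k' _ hk'; simp [Ne.symm hk']
      · simp
    rw [h3, Finset.sum_mul, ← Finset.sum_add_distrib]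
    apply Finset.sum_congr rfl
    intro k' _
    rw [qG_eq]
    change _ = σ (P a k) * _ * P b k'
    rw [hPσ]
    ring
  have heq' : ∀ a b, X a b + Y a b * LaurentPolynomial.T (-2) = (if a = b then 1 else 0) +
      ((N₁ a b - (if a = b then 1 else 0) : ℤ) : LaurentPolynomial ℤ) * LaurentPolynomial.T (-2) := by
    intro a b
    have h1 := congrArg σ (heq a b)
    simp only [map_add, map_mul, hXσ, hYσ, hσT, map_intCast] at h1
    rw [h1]
    congr 1
    split_ifs <;> simp
  have hTne : (LaurentPolynomial.T 2 - LaurentPolynomial.T (-2) : LaurentPolynomial ℤ) ≠ 0 := by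
    intro h0
    have := congrArg (fun p => p.coeff 2) (sub_eq_zero.1 h0)
    simp at this
  have hYe : ∀ a b, Y a b = ((N₁ a b - (if a = b then 1 else 0) : ℤ) : LaurentPolynomial ℤ) := by
    intro a b
    have h1 : (Y a b - ((N₁ a b - (if a = b then 1 else 0) : ℤ) : LaurentPolynomial ℤ)) *
        (LaurentPolynomial.T 2 - LaurentPolynomial.T (-2)) = 0 := by
      linear_combination heq a b - heq' a b
    exact sub_eq_zero.1 ((mul_eq_zero.1 h1).resolve_right hTne)
  have hXe : ∀ a b, X a b = if a = b then 1 else 0 := by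
    intro a b
    have := heq a b
    rw [hYe] at this
    exact add_right_cancel this
  have hcol : ∀ a, ∃ k, ∃ ε : ℤ, (ε = 1 ∨ ε = -1) ∧ P a k = (ε : LaurentPolynomial ℤ) ∧
      ∀ k', k' ≠ k → P a k' = 0 := by
    intro a
    apply sym_sq_sum
    · intro k
      rw [← sigma_coeff σ hσ, hPσ]
    · have := hXe a a
      simpa using this
  choose π ε hε hPε hP0 using hcol
  have hXab : ∀ a b, π a = π b → X a b = ((ε a * ε b : ℤ) : LaurentPolynomial ℤ) := by
    intro a b hab
    simp only [hX]
    rw [Finset.sum_eq_single (π a)]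
    · rw [hPε a, hab, hPε b]; push_cast; rfl
    · intro k _ hk
      rw [hP0 a k hk, zero_mul]
    · simp
  have hinj : Function.Injective π := by
    intro a b hab
    by_contra hne
    have h1 := hXe a b
    rw [hXab a b hab, if_neg hne] at h1
    have h2 : ε a * ε b = 0 := intCast_inj' (by rw [h1]; simp)
    rcases hε a with e1 | e1 <;> rcases hε b with e2 | e2 <;> simp [e1, e2] at h2
  have hcard : Fintype.card ι = Fintype.card κ := by
    have := φ.finrank_eq
    simpa using this
  have hbij : Function.Bijective π := (Fintype.bijective_iff_injective_and_card π).2 ⟨hinj, hcard⟩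
  refine ⟨Equiv.ofBijective π hbij, ε, hε, fun a b => ?_⟩
  have hYab : Y a b = ((ε a * (N₂ (π a) (π b) - if π a = π b then 1 else 0) * ε b : ℤ) :
      LaurentPolynomial ℤ) := by
    simp only [hY]
    rw [Finset.sum_eq_single (π a), Finset.sum_eq_single (π b)]
    · rw [hPε a, hPε b]; push_cast; rfl
    · intro k _ hk
      rw [hP0 b k hk, mul_zero]
    · simp
    · intro k _ hk
      apply Finset.sum_eq_zero
      intro k' _
      rw [hP0 a k hk, zero_mul, zero_mul]
    · simp
  have h1 := intCast_inj' ((hYe a b).symm.trans hYab)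
  simp only [Equiv.ofBijective_apply]
  by_cases hab : a = b
  · subst hab
    simp only [if_true] at h1
    rcases hε a with e1 | e1 <;> rw [e1] at h1 ⊢ <;> linarith
  · rw [if_neg hab, if_neg (fun h => hab (hinj h))] at h1
    linarith

lemma laurent_bwd {ι κ : Type} [Fintype ι] [Fintype κ] [DecidableEq ι] [DecidableEq κ]
    (σ : LaurentPolynomial ℤ →+* LaurentPolynomial ℤ)
    (N₁ : ι → ι → ℤ) (N₂ : κ → κ → ℤ) (π : ι ≃ κ) (ε : ι → ℤ) (hε : ∀ i, ε i = 1 ∨ ε i = -1)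
    (hN : ∀ a b, N₁ a b = ε a * ε b * N₂ (π a) (π b)) :
    ∃ φ : (ι → LaurentPolynomial ℤ) ≃ₗ[LaurentPolynomial ℤ] (κ → LaurentPolynomial ℤ),
    (∀ x y, (∑ e, ∑ e', σ (φ x e) * qG N₂ e e' * φ y e')
          = ∑ e, ∑ e', σ (x e) * qG N₁ e e' * y e') ∧
    (∀ x, φ (fun e => σ (x e)) = fun e' => σ (φ x e')) := by
  have hsq : ∀ i, ((ε i : ℤ) : LaurentPolynomial ℤ) * (ε i : ℤ) = 1 := by
    intro i
    rcases hε i with h | h <;> simp [h]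
  let φ : (ι → LaurentPolynomial ℤ) ≃ₗ[LaurentPolynomial ℤ] (κ → LaurentPolynomial ℤ) :=
    { toFun := fun x k => (ε (π.symm k) : ℤ) * x (π.symm k)
      invFun := fun y i => (ε i : ℤ) * y (π i)
      map_add' := fun x y => by ext1 k; simp [mul_add]
      map_smul' := fun c x => by ext1 k; simp [mul_left_comm]
      left_inv := fun x => by
        ext1 i
        simp only [Equiv.symm_apply_apply]
        rw [← mul_assoc, hsq, one_mul]
      right_inv := fun y => by
        ext1 k
        simp only [Equiv.apply_symm_apply]
        rw [← mul_assoc, hsq, one_mul] }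
  have hφ : ∀ x i, φ x (π i) = (ε i : ℤ) * x i := by
    intro x i
    change (ε (π.symm (π i)) : LaurentPolynomial ℤ) * x (π.symm (π i)) = _
    rw [Equiv.symm_apply_apply]
  refine ⟨φ, fun x y => ?_, fun x => ?_⟩
  · rw [← π.sum_comp]
    apply Finset.sum_congr rfl
    intro a _
    rw [← π.sum_comp]
    apply Finset.sum_congr rfl
    intro b _
    rw [hφ, hφ, map_mul, map_intCast]
    have : qG N₁ a b = (ε a : LaurentPolynomial ℤ) * (ε b : LaurentPolynomial ℤ) * qG N₂ (π a) (π b) := by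
      rw [qG_eq, qG_eq]
      by_cases hab : a = b
      · subst hab
        have : N₁ a a = N₂ (π a) (π a) := by
          rw [hN]; rcases hε a with h | h <;> simp [h]
        rw [hsq, one_mul, this]; simp
      · rw [hN, if_neg hab, if_neg hab, if_neg (fun h => hab (π.injective h)),
          if_neg (fun h => hab (π.injective h))]
        push_cast
        ring
    rw [this]
    ring
  · ext1 k
    change (ε (π.symm k) : LaurentPolynomial ℤ) * σ (x (π.symm k)) =
      σ ((ε (π.symm k) : LaurentPolynomial ℤ) * x (π.symm k))
    rw [map_mul, map_intCast]

/-- A connected spanning edge set `T` of an oriented graph, with its fundamental cuts `K`. -/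
structure CutData {V : Type} [Fintype V] [DecidableEq V] (G : SimpleGraph V)
    (head tail : G.edgeSet → V) (T : Set G.edgeSet)
    (K : {e : G.edgeSet // e ∈ T} → G.edgeSet → ℤ) : Prop where
  hor : IsOrientation G head tail
  conn : (SimpleGraph.fromEdgeSet (Subtype.val '' T)).Connected
  row : ∀ e, ∃ y : V → ℤ, (incMat G head tail).transpose.mulVec y = K e
  diag : ∀ e, K e e.val = 1
  supp : ∀ e (e' : G.edgeSet), e' ∈ T → e' ≠ e.val → K e e' = 0

/-- The sum of a function over the two endpoints. -/
def symSum {V : Type} (z : V → ZMod 2) : Sym2 V → ZMod 2 :=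
  Sym2.lift ⟨fun a b => z a + z b, fun _ _ => add_comm _ _⟩

@[simp] lemma symSum_mk {V : Type} (z : V → ZMod 2) (a b : V) : symSum z s(a, b) = z a + z b := rfl

/-- Even edge sets: elements of the binary cycle space. -/
def EvSet {V : Type} {G : SimpleGraph V} (S : Finset G.edgeSet) : Prop :=
  ∀ z : V → ZMod 2, ∑ f ∈ S, symSum z f.val = 0

lemma zmod2_add_self (a : ZMod 2) : a + a = 0 := by
  revert a; decide

lemma head_ne_tail {V : Type} {G : SimpleGraph V} {head tail : G.edgeSet → V}
    (h : IsOrientation G head tail) (e : G.edgeSet) : head e ≠ tail e := by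
  have h1 := e.2
  rw [h e, SimpleGraph.mem_edgeSet] at h1
  exact h1.ne

lemma inc_mulVec {V : Type} [Fintype V] [DecidableEq V] {G : SimpleGraph V}
    {head tail : G.edgeSet → V} (h : IsOrientation G head tail) (y : V → ℤ) (f : G.edgeSet) :
    (incMat G head tail).transpose.mulVec y f = y (head f) - y (tail f) := by
  have hne := head_ne_tail h f
  simp only [Matrix.mulVec, dotProduct, Matrix.transpose_apply, incMat]
  rw [← Finset.sum_subset (Finset.subset_univ {head f, tail f}), Finset.sum_pair hne]
  · simp [hne.symm]; ring
  · intro x _ hx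
    simp only [Finset.mem_insert, Finset.mem_singleton, not_or] at hx
    simp [hx.1, hx.2]

namespace CutData

variable {V : Type} [Fintype V] [DecidableEq V] {G : SimpleGraph V}
  {head tail : G.edgeSet → V} {T : Set G.edgeSet} {K : {e : G.edgeSet // e ∈ T} → G.edgeSet → ℤ}

lemma const (D : CutData G head tail T K) {A : Type} (y : V → A)
    (h : ∀ e ∈ T, y (head e) = y (tail e)) (u v : V) : y u = y v := by
  obtain ⟨w⟩ := D.conn.preconnected u v
  induction w with
  | nil => rfl
  | cons hadj p ih =>
    rw [← ih]
    rw [SimpleGraph.fromEdgeSet_adj] at hadj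
    obtain ⟨⟨e, he, hev⟩, _⟩ := hadj
    rw [D.hor e] at hev
    have := h e he
    rcases Sym2.eq_iff.1 hev with ⟨h1, h2⟩ | ⟨h1, h2⟩
    · rw [← h1, ← h2, this]
    · rw [← h1, ← h2, this]

lemma diag_eq [DecidableEq {e : G.edgeSet // e ∈ T}] (D : CutData G head tail T K) (e e' : {e : G.edgeSet // e ∈ T}) :
    K e e'.val = if e' = e then 1 else 0 := by
  split_ifs with h
  · rw [h, D.diag]
  · exact D.supp e e'.val e'.2 (fun h' => h (Subtype.ext h'))

open Classical in
lemma expand [Fintype {e : G.edgeSet // e ∈ T}] (D : CutData G head tail T K) (z : V → ℤ)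
    (f : G.edgeSet) :
    z (head f) - z (tail f) = ∑ e : {e : G.edgeSet // e ∈ T},
      (z (head e.val) - z (tail e.val)) * K e f := by
  choose y hy using D.row
  have hy' : ∀ e f, K e f = y e (head f) - y e (tail f) := by
    intro e f
    rw [← hy e, inc_mulVec D.hor]
  have hc := D.const (fun v => z v - ∑ e : {e : G.edgeSet // e ∈ T},
    (z (head e.val) - z (tail e.val)) * y e v) (by
      intro e he
      have : ∑ e' : {e : G.edgeSet // e ∈ T}, (z (head e'.val) - z (tail e'.val)) * K e' e =
          z (head e) - z (tail e) := by
        rw [Finset.sum_eq_single ⟨e, he⟩]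
        · rw [D.diag ⟨e, he⟩, mul_one]
        · intro e' _ hne
          rw [D.supp e' e he (fun h => hne (Subtype.ext h.symm)), mul_zero]
        · simp
      simp only [hy', mul_sub, Finset.sum_sub_distrib] at this
      linarith) (head f) (tail f)
  simp only [hy', mul_sub, Finset.sum_sub_distrib]

  linarith

lemma gh [Fintype {e : G.edgeSet // e ∈ T}] (D : CutData G head tail T K) : GHProp K := by
  classical
  intro I
  choose y hy using D.row
  have hy' : ∀ e f, K e f = y e (head f) - y e (tail f) := by
    intro e f
    rw [← hy e, inc_mulVec D.hor]
  let p : V → ℤ := fun v => (∑ e ∈ I, y e v) % 2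
  have hp : ∀ v, p v = 0 ∨ p v = 1 := fun v => by simp only [p]; omega
  have hc : ∀ e : {e : G.edgeSet // e ∈ T}, (e ∈ I → p (head e.val) - p (tail e.val) = 1 ∨
      p (head e.val) - p (tail e.val) = -1) ∧
      (e ∉ I → p (head e.val) - p (tail e.val) = 0) := by
    intro e
    have : ∑ i ∈ I, K i e.val = if e ∈ I then 1 else 0 := by
      simp only [D.diag_eq]
      simp
    simp only [hy', Finset.sum_sub_distrib] at this
    simp only [p]
    constructor <;> intro h <;> simp only [h, if_true, if_false] at this <;> omega
  refine ⟨fun e => if e ∈ I then p (head e.val) - p (tail e.val) else 1, ?_, ?_⟩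
  · intro e
    by_cases h : e ∈ I
    · simp only [h, if_true]; exact (hc e).1 h
    · simp [h]
  · intro f
    have h1 := D.expand p f
    have h2 : ∑ e ∈ I, (if e ∈ I then p (head e.val) - p (tail e.val) else 1) * K e f =
        p (head f) - p (tail f) := by
      rw [h1, ← Finset.sum_subset (Finset.subset_univ I)]
      · apply Finset.sum_congr rfl
        intro e he
        rw [if_pos he]
      · intro e _ he
        rw [(hc e).2 he, zero_mul]
    rw [h2, abs_le]
    rcases hp (head f) with a | a <;> rcases hp (tail f) with b | b <;> rw [a, b] <;> norm_num

lemma supp_ne [Fintype {e : G.edgeSet // e ∈ T}] (D : CutData G head tail T K) (f : G.edgeSet) :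
    ∃ e, K e f ≠ 0 := by
  by_contra hcon
  push Not at hcon
  have h1 := D.expand (Pi.single (head f) 1) f
  rw [Finset.sum_eq_zero (fun e _ => by rw [hcon, mul_zero])] at h1
  simp [(head_ne_tail D.hor f).symm] at h1

lemma eq_of_supp [Fintype {e : G.edgeSet // e ∈ T}] (D : CutData G head tail T K) (f : G.edgeSet)
    (e : {e : G.edgeSet // e ∈ T}) (h : ∀ e', K e' f ≠ 0 ↔ e' = e) : f = e.val := by
  classical
  have h1 : ∀ z : V → ℤ, z (head f) - z (tail f) = (z (head e.val) - z (tail e.val)) * K e f := by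
    intro z
    rw [D.expand z f]
    apply Finset.sum_eq_single e
    · intro e' _ hne
      have : K e' f = 0 := by
        by_contra hc
        exact hne ((h e').1 hc)
      rw [this, mul_zero]
    · simp
  have hne := head_ne_tail D.hor f
  have a1 : head f = head e.val ∨ head f = tail e.val := by
    by_contra hc
    push Not at hc
    have := h1 (Pi.single (head f) 1)
    simp [hne.symm, hc.1.symm, hc.2.symm] at this
  have a2 : tail f = head e.val ∨ tail f = tail e.val := by
    by_contra hc
    push Not at hc
    have := h1 (Pi.single (tail f) 1)
    simp [hne, hc.1.symm, hc.2.symm] at this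
  apply Subtype.ext
  rw [D.hor f, D.hor e.val, Sym2.eq_iff]
  rcases a1 with a1 | a1 <;> rcases a2 with a2 | a2
  · exact absurd (a1.trans a2.symm) hne
  · exact Or.inl ⟨a1, a2⟩
  · exact Or.inr ⟨a1, a2⟩
  · exact absurd (a1.trans a2.symm) hne

lemma ev_iff [Fintype {e : G.edgeSet // e ∈ T}] (D : CutData G head tail T K)
    (S : Finset G.edgeSet) : EvSet S ↔ ∀ e, ∑ f ∈ S, (K e f : ZMod 2) = 0 := by
  have hsub : ∀ a b : ZMod 2, a + b = a - b := by decide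
  constructor
  · intro h e
    obtain ⟨y, hy⟩ := D.row e
    rw [← h (fun v => (y v : ZMod 2))]
    apply Finset.sum_congr rfl
    intro f _
    rw [← hy, inc_mulVec D.hor, D.hor f, symSum_mk, hsub]
    push_cast
    rfl
  · intro h z
    let y : V → ℤ := fun v => ((z v).val : ℤ)
    have hy : ∀ v, ((y v : ℤ) : ZMod 2) = z v := by
      intro v
      simp [y]
    have : ∀ f : G.edgeSet, symSum z f.val = ∑ e : {e : G.edgeSet // e ∈ T},
        ((y (head e.val) - y (tail e.val) : ℤ) : ZMod 2) * (K e f : ZMod 2) := by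
      intro f
      have h1 := congrArg (fun n : ℤ => (n : ZMod 2)) (D.expand y f)

      rw [D.hor f, symSum_mk, hsub, ← hy, ← hy]
      push_cast at h1 ⊢
      exact h1
    rw [Finset.sum_congr rfl (fun f _ => this f), Finset.sum_comm]
    apply Finset.sum_eq_zero
    intro e _
    rw [← Finset.mul_sum, h e, mul_zero]

lemma cast_eq [Fintype {e : G.edgeSet // e ∈ T}] (D : CutData G head tail T K)
    (e : {e : G.edgeSet // e ∈ T}) (f : G.edgeSet) :
    (K e f : ZMod 2) = if K e f ≠ 0 then 1 else 0 := by
  rcases D.gh.entry e f with h | h | h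
  · simp [h]
  · simp [h]
  · simp [h]

open Classical in
lemma sum_tree (D : CutData G head tail T K) (C : Finset G.edgeSet) (hC : ∀ g ∈ C, g ∈ T)
    (e : {e : G.edgeSet // e ∈ T}) :
    ∑ g ∈ C, (K e g : ZMod 2) = if e.val ∈ C then 1 else 0 := by
  have : ∀ g ∈ C, (K e g : ZMod 2) = if e.val = g then 1 else 0 := by
    intro g hg
    split_ifs with h
    · rw [← h, D.diag]; simp
    · rw [D.supp e g (hC g hg) (Ne.symm h)]; simp
  rw [Finset.sum_congr rfl this]
  simp

open Classical in
lemma fund_parity [Fintype {e : G.edgeSet // e ∈ T}] (D : CutData G head tail T K)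
    (C : Finset G.edgeSet) (f : G.edgeSet) (hfC : f ∈ C) (hfT : f ∉ T)
    (hC : ∀ g ∈ C, g ≠ f → g ∈ T) :
    EvSet C ↔ ∀ e, e.val ∈ C ↔ K e f ≠ 0 := by
  rw [D.ev_iff]
  apply forall_congr'
  intro e
  rw [← Finset.add_sum_erase C _ hfC, D.sum_tree (C.erase f) (fun g hg =>
    hC g (Finset.mem_of_mem_erase hg) (Finset.ne_of_mem_erase hg)), D.cast_eq]
  have hne : e.val ≠ f := by rintro rfl; exact hfT e.2
  have : e.val ∈ C.erase f ↔ e.val ∈ C := by simp [hne]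
  simp only [this]
  by_cases h1 : K e f = 0 <;> by_cases h2 : e.val ∈ C <;> simp [h1, h2] <;> decide

end CutData

lemma EvSet.sdiff {V : Type} {G : SimpleGraph V} [DecidableEq G.edgeSet] {S S' : Finset G.edgeSet}
    (h : EvSet S) (h' : EvSet S') (hs : S' ⊆ S) : EvSet (S \ S') := by
  intro z
  have := Finset.sum_sdiff hs (f := fun f : G.edgeSet => symSum z f.val)
  rw [h z, h' z, add_zero] at this
  exact this

lemma walk_symSum {V : Type} {G : SimpleGraph V} {u v : V} (p : G.Walk u v) (z : V → ZMod 2) :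
    (p.edges.map (symSum z)).sum = z u + z v := by
  induction p with
  | nil => simp [zmod2_add_self]
  | @cons a b c h p ih =>
    rw [SimpleGraph.Walk.edges_cons, List.map_cons, List.sum_cons, ih, symSum_mk]
    linear_combination zmod2_add_self (z b)

lemma IsCycleSet.ev {V : Type} {G : SimpleGraph V} {S : Finset G.edgeSet}
    (h : IsCycleSet G (S : Set G.edgeSet)) : EvSet S := by
  classical
  obtain ⟨u, w, hw, hS⟩ := h
  intro z
  have hS' : S.image Subtype.val = w.edges.toFinset := by
    ext x
    have := Set.ext_iff.1 hS x
    simpa using this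
  have h1 : ∑ f ∈ S, symSum z f.val = ∑ x ∈ S.image Subtype.val, symSum z x := by
    rw [Finset.sum_image (fun a _ b _ h => Subtype.ext h)]
  rw [h1, hS', List.sum_toFinset _ hw.isCircuit.isTrail.edges_nodup, walk_symSum, zmod2_add_self]

lemma path_even_empty {V : Type} {G : SimpleGraph V} {u v : V} (p : G.Walk u v) (hp : p.IsPath)
    (S : Finset G.edgeSet) (hS : ∀ f ∈ S, f.val ∈ p.edges)
    (hev : EvSet S) : S = ∅ := by
  classical
  induction p with
  | nil =>
    rw [Finset.eq_empty_iff_forall_notMem]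
    intro f hf
    simpa using hS f hf
  | @cons a b c h p ih =>
    rw [SimpleGraph.Walk.cons_isPath_iff] at hp
    apply ih hp.1
    intro f hf
    have h1 := hS f hf
    rw [SimpleGraph.Walk.edges_cons, List.mem_cons] at h1
    rcases h1 with h1 | h1
    · exfalso
      have h2 := hev (Pi.single a 1)
      rw [Finset.sum_eq_single f] at h2
      · rw [h1, symSum_mk] at h2
        simp [h.ne.symm] at h2
      · intro g hg hgf
        have h3 := hS g hg
        rw [SimpleGraph.Walk.edges_cons, List.mem_cons] at h3
        rcases h3 with h3 | h3
        · exact absurd (Subtype.ext (h3.trans h1.symm)) hgf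
        · obtain ⟨g, hg'⟩ := g
          induction g using Sym2.ind with
          | _ x y =>
            have hx : x ≠ a := by
              rintro rfl
              exact hp.2 (p.fst_mem_support_of_mem_edges h3)
            have hy : y ≠ a := by
              rintro rfl
              exact hp.2 (p.snd_mem_support_of_mem_edges h3)
            simp [hx, hy]
      · intro hf'; exact absurd hf hf'
    · exact h1

lemma IsCycleSet.minimal {V : Type} {G : SimpleGraph V} {S : Finset G.edgeSet}
    (h : IsCycleSet G (S : Set G.edgeSet)) : S.Nonempty ∧ ∀ S' ⊆ S, EvSet S' → S' = ∅ ∨ S' = S := by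
  classical
  have hev := h.ev
  obtain ⟨u, w, hw, hS⟩ := h
  have hS' : ∀ f : G.edgeSet, f ∈ S ↔ f.val ∈ w.edges := by
    intro f
    have := Set.ext_iff.1 hS f.val
    simpa using this
  cases w with
  | nil => exact absurd rfl hw.ne_nil
  | cons hadj p =>
    rw [SimpleGraph.Walk.cons_isCycle_iff] at hw
    have key : ∀ S' ⊆ S, EvSet S' → (⟨s(u, _), hadj⟩ : G.edgeSet) ∉ S' → S' = ∅ := by
      intro S' hs he hn
      apply path_even_empty p hw.1 S' _ he
      intro f hf
      have := (hS' f).1 (hs hf)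
      rw [SimpleGraph.Walk.edges_cons, List.mem_cons] at this
      rcases this with h1 | h1
      · exfalso
        apply hn
        convert hf using 1
        exact Subtype.ext h1.symm
      · exact h1
    refine ⟨⟨⟨s(u, _), hadj⟩, (hS' _).2 (by simp)⟩, fun S' hs he => ?_⟩
    by_cases hm : (⟨s(u, _), hadj⟩ : G.edgeSet) ∈ S'
    · right
      have := key (S \ S') Finset.sdiff_subset (hev.sdiff he hs) (by simp [hm])
      rw [Finset.sdiff_eq_empty_iff_subset] at this
      exact hs.antisymm this
    · left
      exact key S' hs he hm

lemma cycle_of_minimal {V : Type} {G : SimpleGraph V} {S : Finset G.edgeSet}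
    (hne : S.Nonempty) (hev : EvSet S) (hmin : ∀ S' ⊆ S, EvSet S' → S' = ∅ ∨ S' = S) :
    IsCycleSet G (S : Set G.edgeSet) := by
  classical
  obtain ⟨⟨f, hfG⟩, hf⟩ := hne
  induction f using Sym2.ind with
  | _ a b =>
  set H : SimpleGraph V := SimpleGraph.fromEdgeSet (Subtype.val '' (S : Set G.edgeSet)) with hH
  have hle : H ≤ G := by
    intro x y hxy
    rw [hH, SimpleGraph.fromEdgeSet_adj] at hxy
    obtain ⟨⟨e, _, he⟩, _⟩ := hxy
    have := e.2
    rw [he] at this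
    exact this
  have hab : H.Adj a b := by
    rw [hH, SimpleGraph.fromEdgeSet_adj]
    exact ⟨⟨_, hf, rfl⟩, SimpleGraph.Adj.ne (G := G) hfG⟩
  have hreach : (H \ SimpleGraph.fromEdgeSet {s(a, b)}).Reachable a b := by
    by_contra hcon
    have h1 := hev (fun v => if (H \ SimpleGraph.fromEdgeSet {s(a, b)}).Reachable a v then 1 else 0)
    rw [Finset.sum_eq_single ⟨s(a, b), hfG⟩] at h1
    · simp [hcon] at h1
    · rintro ⟨g, hg⟩ hgS hgf
      induction g using Sym2.ind with
      | _ x y =>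
        have hadj : (H \ SimpleGraph.fromEdgeSet {s(a, b)}).Adj x y := by
          rw [SimpleGraph.sdiff_adj]
          refine ⟨?_, ?_⟩
          · rw [hH, SimpleGraph.fromEdgeSet_adj]
            exact ⟨⟨_, hgS, rfl⟩, SimpleGraph.Adj.ne (G := G) hg⟩
          · rw [SimpleGraph.fromEdgeSet_adj]
            rintro ⟨h2, _⟩
            exact hgf (Subtype.ext h2)
        have : (H \ SimpleGraph.fromEdgeSet {s(a, b)}).Reachable a x ↔
            (H \ SimpleGraph.fromEdgeSet {s(a, b)}).Reachable a y :=
          ⟨fun h => h.trans hadj.reachable, fun h => h.trans hadj.symm.reachable⟩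
        rw [symSum_mk]
        simp only [this]
        exact zmod2_add_self _
    · intro h; exact absurd hf h
  obtain ⟨u, w, hw, hmem⟩ := SimpleGraph.adj_and_reachable_delete_edges_iff_exists_cycle.1
    ⟨hab, hreach⟩
  set S' := S.filter (fun f => f.val ∈ w.edges) with hS'
  have hcyc : IsCycleSet G (S' : Set G.edgeSet) := by
    refine ⟨u, w.mapLe hle, hw.mapLe hle, ?_⟩
    ext x
    simp only [SimpleGraph.Walk.edges_mapLe_eq_edges, Set.mem_ofPred_eq, Set.mem_image]
    constructor
    · rintro ⟨f, hf, rfl⟩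
      simp only [hS', Finset.coe_filter, Set.mem_ofPred_eq] at hf
      exact hf.2
    · intro hx
      have := w.edges_subset_edgeSet hx
      rw [hH, SimpleGraph.edgeSet_fromEdgeSet] at this
      obtain ⟨f, hf, rfl⟩ := this.1
      exact ⟨f, by simp only [hS', Finset.coe_filter, Set.mem_ofPred_eq]; exact ⟨hf, hx⟩, rfl⟩
  rcases hmin S' (Finset.filter_subset _ _) hcyc.ev with h | h
  · have : (⟨s(a, b), hfG⟩ : G.edgeSet) ∈ S' := by
      rw [hS', Finset.mem_filter]; exact ⟨hf, hmem⟩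
    rw [h] at this
    simp at this
  · rwa [h] at hcyc

lemma isCycleSet_iff {V : Type} {G : SimpleGraph V} {S : Finset G.edgeSet} :
    IsCycleSet G (S : Set G.edgeSet) ↔
      S.Nonempty ∧ EvSet S ∧ ∀ S' ⊆ S, EvSet S' → S' = ∅ ∨ S' = S :=
  ⟨fun h => ⟨h.minimal.1, h.ev, h.minimal.2⟩, fun h => cycle_of_minimal h.1 h.2.1 h.2.2⟩

lemma cycle_transfer {V₁ V₂ : Type} {G₁ : SimpleGraph V₁} {G₂ : SimpleGraph V₂}
    (F : G₁.edgeSet ≃ G₂.edgeSet)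
    (hF : ∀ S : Finset G₁.edgeSet, EvSet S ↔ EvSet (S.map F.toEmbedding)) (S : Finset G₁.edgeSet) :
    IsCycleSet G₁ (S : Set G₁.edgeSet) ↔ IsCycleSet G₂ (S.map F.toEmbedding : Set G₂.edgeSet) := by
  rw [isCycleSet_iff, isCycleSet_iff, ← hF, Finset.map_nonempty]
  refine and_congr_right fun _ => and_congr_right fun _ => ?_
  constructor
  · intro h S' hS' he
    obtain ⟨R, hR, rfl⟩ := Finset.subset_map_iff.1 hS'
    rcases h R hR ((hF R).2 he) with h | h
    · left; simp [h]
    · right; rw [h]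
  · intro h S' hS' he
    rcases h (S'.map F.toEmbedding) (Finset.map_subset_map.2 hS') ((hF _).1 he) with h | h
    · left; simpa using h
    · right; exact Finset.map_injective _ h

open Classical in
lemma fund_cycle {V : Type} [Fintype V] [DecidableEq V] {G : SimpleGraph V}
    {head tail : G.edgeSet → V} {T : Set G.edgeSet} {K : {e : G.edgeSet // e ∈ T} → G.edgeSet → ℤ}
    [Fintype {e : G.edgeSet // e ∈ T}] (D : CutData G head tail T K) (f : G.edgeSet) (hf : f ∉ T) :
    IsCycleSet G ((insert f ((Finset.univ.filter (fun e => K e f ≠ 0)).map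
      (Function.Embedding.subtype _)) : Finset G.edgeSet) : Set G.edgeSet) := by
  set C : Finset G.edgeSet := insert f ((Finset.univ.filter (fun e => K e f ≠ 0)).map
      (Function.Embedding.subtype _)) with hC
  have hCT : ∀ g ∈ C, g ≠ f → g ∈ T := by
    intro g hg hgf
    rw [hC, Finset.mem_insert] at hg
    rcases hg with hg | hg
    · exact absurd hg hgf
    · obtain ⟨e, _, rfl⟩ := Finset.mem_map.1 hg
      exact e.2
  have hfC : f ∈ C := Finset.mem_insert_self _ _
  have hCe : ∀ e : {e : G.edgeSet // e ∈ T}, e.val ∈ C ↔ K e f ≠ 0 := by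
    intro e
    have hne : e.val ≠ f := by rintro rfl; exact hf e.2
    rw [hC, Finset.mem_insert]
    simp [hne]
  apply cycle_of_minimal ⟨f, hfC⟩ ((D.fund_parity C f hfC hf hCT).2 hCe)
  intro S' hS' hev
  by_cases hfS : f ∈ S'
  · right
    have hp := (D.fund_parity S' f hfS hf (fun g hg => hCT g (hS' hg))).1 hev
    apply hS'.antisymm
    intro g hg
    by_cases hgf : g = f
    · rwa [hgf]
    · have hgT := hCT g hg hgf
      exact (hp ⟨g, hgT⟩).2 ((hCe ⟨g, hgT⟩).1 hg)
  · left
    have hST : ∀ g ∈ S', g ∈ T := fun g hg => hCT g (hS' hg) (by rintro rfl; exact hfS hg)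
    rw [Finset.eq_empty_iff_forall_notMem]
    intro g hg
    have := (D.ev_iff S').1 hev ⟨g, hST g hg⟩
    rw [D.sum_tree S' hST] at this
    simp [hg] at this

lemma qCutGram_eq {V : Type} [DecidableEq V] (G : SimpleGraph V)
    [Fintype G.edgeSet] (T : Set G.edgeSet)
    (K : {e : G.edgeSet // e ∈ T} → G.edgeSet → ℤ) (e e' : {e : G.edgeSet // e ∈ T}) :
    qCutGram G T K e e' = qG (fun e e' => ∑ f, K e f * K e' f) e e' := rfl

lemma GHProp.comap {ι E E' : Type} {K : ι → E → ℤ} (h : GHProp K) (F : E' → E) :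
    GHProp (fun i f => K i (F f)) := by
  intro I
  obtain ⟨ε, hε, hb⟩ := h I
  exact ⟨ε, hε, fun f => hb (F f)⟩

section Main

variable {V₁ V₂ : Type} [Fintype V₁] [Fintype V₂] [DecidableEq V₁] [DecidableEq V₂]
    {G₁ : SimpleGraph V₁} {G₂ : SimpleGraph V₂}
    [Fintype G₁.edgeSet] [Fintype G₂.edgeSet]
    {head₁ tail₁ : G₁.edgeSet → V₁} {head₂ tail₂ : G₂.edgeSet → V₂}
    {T₁ : Set G₁.edgeSet} {T₂ : Set G₂.edgeSet}
    [Fintype {e : G₁.edgeSet // e ∈ T₁}] [Fintype {e : G₂.edgeSet // e ∈ T₂}]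
    {K₁ : {e : G₁.edgeSet // e ∈ T₁} → G₁.edgeSet → ℤ}
    {K₂ : {e : G₂.edgeSet // e ∈ T₂} → G₂.edgeSet → ℤ}

lemma main_fwd (D₁ : CutData G₁ head₁ tail₁ T₁ K₁) (D₂ : CutData G₂ head₂ tail₂ T₂ K₂)
    (π : {e : G₁.edgeSet // e ∈ T₁} ≃ {e : G₂.edgeSet // e ∈ T₂})
    (ε : {e : G₁.edgeSet // e ∈ T₁} → ℤ) (hε : ∀ i, ε i = 1 ∨ ε i = -1)
    (hN : ∀ a b, ∑ f, K₁ a f * K₁ b f = ε a * ε b * ∑ f, K₂ (π a) f * K₂ (π b) f) :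
    ∃ F : G₁.edgeSet ≃ G₂.edgeSet,
        (∀ S : Set G₁.edgeSet, IsCycleSet G₁ S ↔ IsCycleSet G₂ (⇑F '' S)) ∧
        ⇑F '' T₁ = T₂ := by
  classical
  have hε0 : ∀ i, ε i ≠ 0 := fun i => by rcases hε i with h | h <;> simp [h]
  obtain ⟨F, hF'⟩ := exists_support_equiv D₁.gh (D₂.gh.scale π.toEmbedding ε hε) (by
    intro i j
    rw [hN, Finset.mul_sum]
    apply Finset.sum_congr rfl
    intro f _
    simp only [Equiv.coe_toEmbedding]
    ring) D₁.supp_ne (by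
    intro f
    obtain ⟨e, he⟩ := D₂.supp_ne f
    exact ⟨π.symm e, by simpa using ⟨hε0 _, he⟩⟩)
  have hF : ∀ i f, K₂ (π i) (F f) ≠ 0 ↔ K₁ i f ≠ 0 := by
    intro i f
    rw [← hF' i f]
    simp [hε0]
  have hev : ∀ S : Finset G₁.edgeSet, EvSet S ↔ EvSet (S.map F.toEmbedding) := by
    intro S
    rw [D₁.ev_iff, D₂.ev_iff, ← π.forall_congr_right]
    apply forall_congr'
    intro e
    rw [Finset.sum_map]
    have : ∑ f ∈ S, (K₁ e f : ZMod 2) = ∑ f ∈ S, (K₂ (π e) (F.toEmbedding f) : ZMod 2) := by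
      apply Finset.sum_congr rfl
      intro f _
      rw [D₁.cast_eq, D₂.cast_eq]
      simp only [Equiv.coe_toEmbedding, hF]
    rw [this]
  have hFπ : ∀ e : {e : G₁.edgeSet // e ∈ T₁}, F e.val = (π e).val := by
    intro e
    apply D₂.eq_of_supp
    intro e'
    obtain ⟨e', rfl⟩ := π.surjective e'
    rw [hF, D₁.diag_eq]
    rw [π.apply_eq_iff_eq]
    by_cases h : e' = e
    · simp [h]
    · simp [h, Ne.symm h]
  refine ⟨F, fun S => ?_, ?_⟩
  · have := cycle_transfer F hev S.toFinset
    rw [Finset.coe_map, Set.coe_toFinset] at this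
    exact this
  · ext x
    constructor
    · rintro ⟨e, he, rfl⟩
      rw [hFπ ⟨e, he⟩]
      exact (π _).2
    · intro hx
      refine ⟨(π.symm ⟨x, hx⟩).val, (π.symm ⟨x, hx⟩).2, ?_⟩
      rw [hFπ]
      simp

lemma main_bwd (D₁ : CutData G₁ head₁ tail₁ T₁ K₁) (D₂ : CutData G₂ head₂ tail₂ T₂ K₂)
    (F : G₁.edgeSet ≃ G₂.edgeSet)
    (hF : ∀ S : Set G₁.edgeSet, IsCycleSet G₁ S ↔ IsCycleSet G₂ (⇑F '' S))
    (hT : ⇑F '' T₁ = T₂) :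
    ∃ (π : {e : G₁.edgeSet // e ∈ T₁} ≃ {e : G₂.edgeSet // e ∈ T₂})
    (ε : {e : G₁.edgeSet // e ∈ T₁} → ℤ), (∀ i, ε i = 1 ∨ ε i = -1) ∧
      ∀ a b, ∑ f, K₁ a f * K₁ b f = ε a * ε b * ∑ f, K₂ (π a) f * K₂ (π b) f := by
  classical
  have hmem : ∀ e, e ∈ T₁ ↔ F e ∈ T₂ := by
    intro e
    rw [← hT]
    simp
  let π : {e : G₁.edgeSet // e ∈ T₁} ≃ {e : G₂.edgeSet // e ∈ T₂} := F.subtypeEquiv hmem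
  have hπ : ∀ e, (π e).val = F e.val := fun e => rfl
  have hsupp : ∀ e f, K₂ (π e) (F f) ≠ 0 ↔ K₁ e f ≠ 0 := by
    intro e f
    by_cases hf : f ∈ T₁
    · have h1 := D₁.diag_eq e ⟨f, hf⟩
      have h2 := D₂.diag_eq (π e) (π ⟨f, hf⟩)
      rw [hπ] at h2
      simp only at h1 h2
      rw [h1, h2]
      simp
    · have hc := fund_cycle D₁ f hf
      rw [hF, ← Equiv.coe_toEmbedding, ← Finset.coe_map] at hc
      have h1 := (D₂.fund_parity _ (F f) (by simp) (by rwa [← hmem]) (by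
        intro g hg hgf
        obtain ⟨g, rfl⟩ := F.surjective g
        simp only [Finset.map_insert, Finset.mem_insert, Equiv.coe_toEmbedding] at hg
        rcases hg with hg | hg
        · exact absurd hg hgf
        · rw [← hmem]
          simp at hg
          exact hg.choose)).1 hc.ev (π e)
      rw [← h1, hπ]
      have hne : e.val ≠ f := by rintro rfl; exact hf e.2
      simp [hne]
  have hgh : GHProp (fun e f => K₂ (π e) (F f)) := by
    have := (D₂.gh.scale π.toEmbedding (fun _ => 1) (fun _ => Or.inl rfl)).comap F
    simpa using this
  obtain ⟨ε, hε, h⟩ := exists_signs D₁.gh hgh hsupp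
  refine ⟨π, ε, hε, fun a b => ?_⟩
  rw [h a b, F.sum_comp (fun f => K₂ (π a) f * K₂ (π b) f)]

end Main

/-- q-analog of the Su–Wagner/Caporaso–Viviani theorem, cut version.
For `i = 1,2`, let `Γᵢ` be a finite 2-edge-connected oriented simple graph with spanning
tree `Tᵢ` and fundamental cuts `Kᵢ`.  Then the q-cut lattices of `(Γ₁,T₁)` and `(Γ₂,T₂)`
are isomorphic (as `R = ℤ[q,q⁻¹]`-modules with a form, compatibly with the bar
involutions fixing the fundamental-cut bases) if and only if there is a cycle-preserving
bijection `F : E₁ → E₂` with `F(T₁) = T₂`. -/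
theorem stmt12
    (σ : LaurentPolynomial ℤ →+* LaurentPolynomial ℤ)
    (hσ : σ (LaurentPolynomial.T 1) = LaurentPolynomial.T (-1))
    (V₁ V₂ : Type) [Fintype V₁] [Fintype V₂] [DecidableEq V₁] [DecidableEq V₂]
    (G₁ : SimpleGraph V₁) (G₂ : SimpleGraph V₂)
    [Fintype G₁.edgeSet] [Fintype G₂.edgeSet]
    (head₁ tail₁ : G₁.edgeSet → V₁) (head₂ tail₂ : G₂.edgeSet → V₂)
    (hor₁ : IsOrientation G₁ head₁ tail₁) (hor₂ : IsOrientation G₂ head₂ tail₂)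
    (h2ec₁ : TwoEdgeConnected G₁) (h2ec₂ : TwoEdgeConnected G₂)
    (T₁ : Set G₁.edgeSet) (T₂ : Set G₂.edgeSet)
    [DecidablePred (· ∈ T₁)] [DecidablePred (· ∈ T₂)]
    (hT₁ : IsSpanningTree G₁ T₁) (hT₂ : IsSpanningTree G₂ T₂)
    (K₁ : {e : G₁.edgeSet // e ∈ T₁} → G₁.edgeSet → ℤ)
    (K₂ : {e : G₂.edgeSet // e ∈ T₂} → G₂.edgeSet → ℤ)
    (hK₁row : ∀ e, ∃ y : V₁ → ℤ, (incMat G₁ head₁ tail₁).transpose.mulVec y = K₁ e)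
    (hK₁e : ∀ e, K₁ e e.val = 1)
    (hK₁supp : ∀ e (e' : G₁.edgeSet), e' ∈ T₁ → e' ≠ e.val → K₁ e e' = 0)
    (hK₂row : ∀ e, ∃ y : V₂ → ℤ, (incMat G₂ head₂ tail₂).transpose.mulVec y = K₂ e)
    (hK₂e : ∀ e, K₂ e e.val = 1)
    (hK₂supp : ∀ e (e' : G₂.edgeSet), e' ∈ T₂ → e' ≠ e.val → K₂ e e' = 0) :
    (∃ φ : ({e : G₁.edgeSet // e ∈ T₁} → LaurentPolynomial ℤ) ≃ₗ[LaurentPolynomial ℤ]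
        ({e : G₂.edgeSet // e ∈ T₂} → LaurentPolynomial ℤ),
      (∀ x y, (∑ e, ∑ e', σ (φ x e) * qCutGram G₂ T₂ K₂ e e' * φ y e')
          = ∑ e, ∑ e', σ (x e) * qCutGram G₁ T₁ K₁ e e' * y e') ∧
      (∀ x, φ (fun e => σ (x e)) = fun e' => σ (φ x e')))
    ↔ (∃ F : G₁.edgeSet ≃ G₂.edgeSet,
        (∀ S : Set G₁.edgeSet, IsCycleSet G₁ S ↔ IsCycleSet G₂ (⇑F '' S)) ∧
        ⇑F '' T₁ = T₂) := by
  have D₁ : CutData G₁ head₁ tail₁ T₁ K₁ := ⟨hor₁, hT₁.1, hK₁row, hK₁e, hK₁supp⟩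
  have D₂ : CutData G₂ head₂ tail₂ T₂ K₂ := ⟨hor₂, hT₂.1, hK₂row, hK₂e, hK₂supp⟩
  constructor
  · rintro ⟨φ, hform, hbar⟩
    simp only [qCutGram_eq] at hform
    obtain ⟨π, ε, hε, hN⟩ := laurent_fwd σ hσ _ _ φ hform hbar
    exact main_fwd D₁ D₂ π ε hε hN
  · rintro ⟨F, hF, hT⟩
    obtain ⟨π, ε, hε, hN⟩ := main_bwd D₁ D₂ F hF hT
    simp only [qCutGram_eq]
    exact laurent_bwd σ _ _ π ε hε hN
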